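/- arXiv:2009.01098 — 3 statements merged into one kernel-verified Lean document; each statement's English description precedes it below -/
import Mathlib

section
/- Let C be a real M \times N matrix such that every row of C has exactly one nonzero entry, equal to 1 or -1, let d_i be the number of rows of C whose nonzero entry lies in column i, and let c > 0. Then the matrix I + c\,C^T C is invertible, and for every s \in \mathbb{R}^N the vector x^{(1)} = (I + c\,C^T C)^{-1} s satisfies x^{(1)}_i = s_i/(1 + c\,d_i) for every i. In particular, in PDMM with zero initialization x^{(0)} = 0, \lambda^{(0)} = 0, the first broadcast state value of node i equals s_i/(1 + c\,d_i), so the private data s_i is determined by x^{(1)}_i, c and d_i. -/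
open Matrix Finset

/-- The Gram matrix of a matrix with exactly one nonzero entry, equal to `±1`, in each row is
diagonal, and its diagonal counts the nonzero entries of each column. -/
theorem transpose_mul_self_eq_diagonal_card {m n : Type*} [Fintype m] [DecidableEq n]
    (C : Matrix m n ℝ) (hrow : ∀ r, ∃! j, C r j ≠ 0)
    (hval : ∀ r j, C r j ≠ 0 → C r j = 1 ∨ C r j = -1) :
    Cᵀ * C = diagonal fun i => ((Finset.univ.filter fun r => C r i ≠ 0).card : ℝ) := by
  ext i j
  rw [mul_apply]
  simp only [transpose_apply]
  by_cases hij : i = j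
  · subst hij
    rw [diagonal_apply_eq, Finset.card_filter, Nat.cast_sum]
    refine Finset.sum_congr rfl fun r _ => ?_
    by_cases h : C r i = 0
    · simp [h]
    · rcases hval r i h with h | h <;> simp [h]
  · rw [diagonal_apply_ne _ hij]
    refine Finset.sum_eq_zero fun r _ => ?_
    by_contra h
    exact hij ((hrow r).unique (left_ne_zero_of_mul h) (right_ne_zero_of_mul h))

/-- PDMM privacy leakage with zero initialization: if every row of `C` has exactly one
nonzero entry equal to `±1`, `d i` is the number of rows with nonzero entry in column `i`,
and `c > 0`, then `I + c CᵀC` is invertible and the first state value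
`x⁽¹⁾ = (I + c CᵀC)⁻¹ s` satisfies `x⁽¹⁾ᵢ = sᵢ / (1 + c dᵢ)`; in particular the private
data `sᵢ` is determined by `x⁽¹⁾ᵢ`, `c` and `dᵢ`. -/
theorem pdmm_first_iterate_reveals_private_data
    {M N : ℕ} (C : Matrix (Fin M) (Fin N) ℝ)
    (hrow : ∀ r : Fin M, ∃! j : Fin N, C r j ≠ 0)
    (hval : ∀ (r : Fin M) (j : Fin N), C r j ≠ 0 → C r j = 1 ∨ C r j = -1)
    (c : ℝ) (hc : 0 < c) :
    IsUnit ((1 : Matrix (Fin N) (Fin N) ℝ) + c • (Cᵀ * C)) ∧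
    (∀ (s : Fin N → ℝ) (i : Fin N),
      (((1 : Matrix (Fin N) (Fin N) ℝ) + c • (Cᵀ * C))⁻¹).mulVec s i =
        s i / (1 + c * ((Finset.univ.filter fun r : Fin M => C r i ≠ 0).card : ℝ))) ∧
    (∀ (s : Fin N → ℝ) (i : Fin N),
      s i = (1 + c * ((Finset.univ.filter fun r : Fin M => C r i ≠ 0).card : ℝ)) *
        (((1 : Matrix (Fin N) (Fin N) ℝ) + c • (Cᵀ * C))⁻¹).mulVec s i) := by
  have hd (i : Fin N) :
      1 + c * ((Finset.univ.filter fun r : Fin M => C r i ≠ 0).card : ℝ) ≠ 0 := by positivity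
  have hA : (1 : Matrix (Fin N) (Fin N) ℝ) + c • (Cᵀ * C) =
      diagonal fun i => 1 + c * ((Finset.univ.filter fun r : Fin M => C r i ≠ 0).card : ℝ) := by
    rw [transpose_mul_self_eq_diagonal_card C hrow hval, ← diagonal_one, ← diagonal_smul,
      diagonal_add]
    rfl
  have hunit : IsUnit ((1 : Matrix (Fin N) (Fin N) ℝ) + c • (Cᵀ * C)) := by
    rw [hA, isUnit_diagonal, Pi.isUnit_iff]
    exact fun i => (hd i).isUnit
  have hreveal (s : Fin N → ℝ) (i : Fin N) :
      s i = (1 + c * ((Finset.univ.filter fun r : Fin M => C r i ≠ 0).card : ℝ)) *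
        (((1 : Matrix (Fin N) (Fin N) ℝ) + c • (Cᵀ * C))⁻¹).mulVec s i := by
    refine Eq.trans ?_ (mulVec_diagonal (fun i =>
      1 + c * ((Finset.univ.filter fun r : Fin M => C r i ≠ 0).card : ℝ)) _ i)
    rw [← hA, mulVec_mulVec, mul_nonsing_inv _ ((isUnit_iff_isUnit_det _).mp hunit),
      one_mulVec]
  exact ⟨hunit, fun s i => eq_div_of_mul_eq (hd i) ((mul_comm _ _).trans (hreveal s i).symm),
    hreveal⟩
end

section
/- Let U be a finite-dimensional real inner product space, let P : U \to U be a self-adjoint linear map with P \circ P = id, let V be a finite-dimensional real vector space and C : V \to U a linear map. Let \bar{H} = range(C) + range(P \circ C) (a subspace of U) and let \Pi denote the orthogonal projection of U onto \bar{H}. Suppose sequences (x^{(t)})_{t \ge 0} in V and (\lambda^{(t)})_{t \ge 0} in U satisfy \lambda^{(t+1)} = P\lambda^{(t)} + c\,(C x^{(t+1)} + P C x^{(t)}) for all t \ge 0 and some c \in \mathbb{R}. Then P maps \bar{H} into \bar{H}, P maps \bar{H}^{\perp} into \bar{H}^{\perp}, and for every t \ge 0 the non-convergent component satisfies (I - \Pi)\lambda^{(t)}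 = P^t (I - \Pi)\lambda^{(0)}. In particular, (I - \Pi)\lambda^{(t+2)} = (I - \Pi)\lambda^{(t)} for all t. -/
open Submodule

/-- The orthogonal projection onto an invariant subspace commutes with a symmetric operator. -/
theorem LinearMap.IsSymmetric.starProjection_map {𝕜 E : Type*} [RCLike 𝕜]
    [NormedAddCommGroup E] [InnerProductSpace 𝕜 E] {T : E →ₗ[𝕜] E} (hT : T.IsSymmetric)
    {K : Submodule 𝕜 E} [K.HasOrthogonalProjection] (hK : K ∈ Module.End.invtSubmodule T) (v : E) :
    K.starProjection (T v) = T (K.starProjection v) := by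
  refine Submodule.eq_starProjection_of_mem_orthogonal
    (hK (Submodule.starProjection_apply_mem K v)) ?_
  rw [← map_sub]
  exact hT.orthogonalComplement_mem_invtSubmodule hK
    (Submodule.sub_starProjection_mem_orthogonal v)

/-- An involution `P` maps `range C ⊔ range (P ∘ C)` into itself. -/
theorem LinearMap.map_mem_range_sup_range_comp {R U V : Type*} [Ring R]
    [AddCommGroup U] [Module R U] [AddCommGroup V] [Module R V] {P : U →ₗ[R] U}
    (hP : P ∘ₗ P = LinearMap.id) (C : V →ₗ[R] U) {u : U}
    (hu : u ∈ LinearMap.range C ⊔ LinearMap.range (P ∘ₗ C)) :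
    P u ∈ LinearMap.range C ⊔ LinearMap.range (P ∘ₗ C) := by
  obtain ⟨_, ⟨a, rfl⟩, _, ⟨b, rfl⟩, rfl⟩ := Submodule.mem_sup.mp hu
  have hPP : P (P (C b)) = C b := LinearMap.congr_fun hP (C b)
  rw [map_add, add_comm, LinearMap.comp_apply, hPP]
  exact Submodule.add_mem_sup ⟨b, rfl⟩ ⟨a, rfl⟩

/-- DOSP non-convergent dual component: with `H̄ = range C + range (P∘C)`, a self-adjoint
involution `P` maps `H̄` into `H̄` and `H̄ᗮ` into `H̄ᗮ`, and under the PDMM dual update the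
non-convergent component satisfies `(I - Π)λ⁽ᵗ⁾ = Pᵗ (I - Π)λ⁽⁰⁾`; in particular
`(I - Π)λ⁽ᵗ⁺²⁾ = (I - Π)λ⁽ᵗ⁾`. -/
theorem dosp_nonconvergent_component
    {U : Type*} [NormedAddCommGroup U] [InnerProductSpace ℝ U] [FiniteDimensional ℝ U]
    {V : Type*} [AddCommGroup V] [Module ℝ V] [FiniteDimensional ℝ V]
    (P : U →ₗ[ℝ] U) (hPsym : P.IsSymmetric) (hP2 : P ∘ₗ P = LinearMap.id)
    (C : V →ₗ[ℝ] U) (c : ℝ)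
    (x : ℕ → V) (lam : ℕ → U)
    (hupd : ∀ t : ℕ, lam (t + 1) = P (lam t) + c • (C (x (t + 1)) + P (C (x t)))) :
    (∀ u ∈ LinearMap.range C ⊔ LinearMap.range (P ∘ₗ C),
        P u ∈ LinearMap.range C ⊔ LinearMap.range (P ∘ₗ C)) ∧
    (∀ u ∈ (LinearMap.range C ⊔ LinearMap.range (P ∘ₗ C))ᗮ,
        P u ∈ (LinearMap.range C ⊔ LinearMap.range (P ∘ₗ C))ᗮ) ∧
    (∀ t : ℕ,
        lam t - (orthogonalProjection (LinearMap.range C ⊔ LinearMap.range (P ∘ₗ C))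
          (lam t) : U) =
        (P ^ t) (lam 0 -
          (orthogonalProjection (LinearMap.range C ⊔ LinearMap.range (P ∘ₗ C))
            (lam 0) : U))) ∧
    (∀ t : ℕ,
        lam (t + 2) - (orthogonalProjection
          (LinearMap.range C ⊔ LinearMap.range (P ∘ₗ C)) (lam (t + 2)) : U) =
        lam t - (orthogonalProjection
          (LinearMap.range C ⊔ LinearMap.range (P ∘ₗ C)) (lam t) : U)) := by
  have hK : ∀ u ∈ LinearMap.range C ⊔ LinearMap.range (P ∘ₗ C),
      P u ∈ LinearMap.range C ⊔ LinearMap.range (P ∘ₗ C) :=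
    fun _ hu => LinearMap.map_mem_range_sup_range_comp hP2 C hu
  have hmem (t : ℕ) : c • (C (x (t + 1)) + P (C (x t))) ∈
      LinearMap.range C ⊔ LinearMap.range (P ∘ₗ C) :=
    Submodule.smul_mem _ _ (Submodule.add_mem_sup ⟨_, rfl⟩ ⟨_, rfl⟩)
  simp only [Submodule.coe_orthogonalProjectionOnto_apply]
  set K := LinearMap.range C ⊔ LinearMap.range (P ∘ₗ C)
  have hstep (t : ℕ) : lam (t + 1) - K.starProjection (lam (t + 1)) =
      P (lam t - K.starProjection (lam t)) := by
    rw [hupd, map_add, hPsym.starProjection_map hK,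
      Submodule.starProjection_eq_self_iff.mpr (hmem t), add_sub_add_right_eq_sub, map_sub]
  refine ⟨hK, fun _ hu => hPsym.orthogonalComplement_mem_invtSubmodule hK hu, fun t => ?_, fun t => ?_⟩
  · induction t with
    | zero => simp
    | succ t ih => rw [hstep, ih, pow_succ', Module.End.mul_apply]
  · rw [hstep, hstep]
    exact LinearMap.congr_fun hP2 _
end

section
/- Let n, M be positive integers, let C be a real M \times n matrix, let P be a real M \times M matrix with P^T = P and P^2 = I, let c \in \mathbb{R} be such that I + cC^TC is invertible, and let s \in \mathbb{R}^n. Suppose sequences (x^{(t)})_{t \ge 0} in \mathbb{R}^n and (\lambda^{(t)})_{t \ge 0} in \mathbb{R}^M satisfy, for all t \ge 0, the updates x^{(t+1)} = (I + cC^TC)^{-1}(s - cC^T P C x^{(t)} - C^T P \lambda^{(t)}) and \lambda^{(t+1)} = P\lambda^{(t)} + c(C x^{(t+1)} + P C x^{(t)}). Then for every t \ge 2, x^{(t+1)} - x^{(t-1)} = (I + cC^TC)^{-1}\left(-2c\,C^T P C\,x^{(t)} - 2c\,C^T C\,x^{(t-1)}\right). -/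
open Matrix

/-- Two-step PDMM primal recursion: under the PDMM primal and dual updates with
`Pᵀ = P`, `P² = I` and `I + c CᵀC` invertible, for every `t ≥ 2`,
`x⁽ᵗ⁺¹⁾ - x⁽ᵗ⁻¹⁾ = (I + c CᵀC)⁻¹ (-2c CᵀPC x⁽ᵗ⁾ - 2c CᵀC x⁽ᵗ⁻¹⁾)`. -/
theorem pdmm_two_step_primal_recursion
    {n M : ℕ} (hn : 0 < n) (hM : 0 < M)
    (C : Matrix (Fin M) (Fin n) ℝ) (P : Matrix (Fin M) (Fin M) ℝ)
    (hPsym : Pᵀ = P) (hP2 : P * P = 1)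
    (c : ℝ) (hinv : IsUnit ((1 : Matrix (Fin n) (Fin n) ℝ) + c • (Cᵀ * C)))
    (s : Fin n → ℝ) (x : ℕ → Fin n → ℝ) (lam : ℕ → Fin M → ℝ)
    (hxupd : ∀ t : ℕ, x (t + 1) =
      (((1 : Matrix (Fin n) (Fin n) ℝ) + c • (Cᵀ * C))⁻¹).mulVec
        (s - c • (Cᵀ * P * C).mulVec (x t) - (Cᵀ * P).mulVec (lam t)))
    (hlamupd : ∀ t : ℕ, lam (t + 1) =
      P.mulVec (lam t) + c • (C.mulVec (x (t + 1)) + (P * C).mulVec (x t))) :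
    ∀ t : ℕ, 2 ≤ t →
      x (t + 1) - x (t - 1) =
        (((1 : Matrix (Fin n) (Fin n) ℝ) + c • (Cᵀ * C))⁻¹).mulVec
          (-(2 * c) • (Cᵀ * P * C).mulVec (x t) -
            (2 * c) • (Cᵀ * C).mulVec (x (t - 1))) := by
  intro t ht
  obtain ⟨k, rfl⟩ := Nat.exists_eq_add_of_le' ht
  have hdual : (Cᵀ * P) *ᵥ lam (k + 2) = (Cᵀ * P) *ᵥ lam k +
      c • ((Cᵀ * P * C) *ᵥ x (k + 2) + (2 : ℝ) • (Cᵀ * C) *ᵥ x (k + 1) +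
        (Cᵀ * P * C) *ᵥ x k) := by
    have hPP : Cᵀ * P * P = Cᵀ := by rw [Matrix.mul_assoc, hP2, Matrix.mul_one]
    have hPPC : Cᵀ * P * (P * C) = Cᵀ * C := by rw [← Matrix.mul_assoc, hPP]
    rw [hlamupd (k + 1), hlamupd k]
    simp only [mulVec_add, mulVec_smul, mulVec_mulVec, hPP, hPPC, ← Matrix.mul_assoc]
    module
  rw [show k + 2 - 1 = k + 1 from rfl, hxupd (k + 2)]
  conv_lhs => rw [hxupd k]
  rw [← mulVec_sub, hdual]
  congr 1
  module
end
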